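/- Assume ρ is quasi-pure at x and its spectrum is non-degenerate there, i.e. q_k(x) ≠ q_l(x) for all k ≠ l. Then for every SLD L of ρ at x, Tr[ρ(x) L²] = Σ_{n=1}^{r} q_n(x) · 4( ‖φ_n'(x)‖² − |⟨φ_n(x), φ_n'(x)⟩|² ); that is, the quantum Fisher information of ρ equals the convex combination of the pure-state quantum Fisher informations of its eigenvectors, saturating the generalized convexity inequality of the quantum Fisher information. -/

import Mathlib

open Matrix
open scoped Classical

/-- The rank-one matrix `|v⟩⟨w|`, sending `u` to `⟨w, u⟩ v`. -/
noncomputable def ketbra {n : Type*} (v w : n → ℂ) : Matrix n n ℂ :=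
  Matrix.vecMulVec v (star w)

theorem ketbra_mulVec {n : Type*} [Fintype n] (v w u : n → ℂ) :
    ketbra v w *ᵥ u = (star w ⬝ᵥ u) • v := by
  simp [ketbra, Matrix.vecMulVec_mulVec]

theorem trace_ketbra_mul {n : Type*} [Fintype n] (v w : n → ℂ) (A : Matrix n n ℂ) :
    (ketbra v w * A).trace = star w ⬝ᵥ (A *ᵥ v) := by
  rw [ketbra, Matrix.vecMulVec_mul, Matrix.trace_vecMulVec, dotProduct_comm,
    Matrix.dotProduct_mulVec]

theorem sum_smul_ketbra_mulVec {n ι : Type*} [Fintype n] [Fintype ι]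
    (c : ι → ℂ) (φ : ι → n → ℂ) (u : n → ℂ) :
    (∑ k, c k • ketbra (φ k) (φ k)) *ᵥ u = ∑ k, (c k * (star (φ k) ⬝ᵥ u)) • φ k := by
  simp [Matrix.sum_mulVec, Matrix.smul_mulVec, ketbra_mulVec, smul_smul]

/-- The entrywise product rule for a differentiable matrix acting on a differentiable vector. -/
theorem hasDerivAt_mulVec_apply {m n : Type*} [Fintype n] {A : ℝ → Matrix m n ℂ}
    {A' : Matrix m n ℂ} {v : ℝ → n → ℂ} {v' : n → ℂ} {x : ℝ}
    (hA : ∀ i j, HasDerivAt (fun y => A y i j) (A' i j) x)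
    (hv : ∀ j, HasDerivAt (fun y => v y j) (v' j) x) (i : m) :
    HasDerivAt (fun y => (A y *ᵥ v y) i) ((A' *ᵥ v x + A x *ᵥ v') i) x := by
  simp only [Matrix.mulVec, dotProduct, Pi.add_apply, ← Finset.sum_add_distrib]
  exact HasDerivAt.fun_sum fun j _ => (hA i j).mul (hv j)

/-- The squared norm of the component of `w` orthogonal to a unit vector `v`. -/
theorem star_dotProduct_sub_smul_self {n : Type*} [Fintype n] {v : n → ℂ}
    (hv : star v ⬝ᵥ v = 1) (w : n → ℂ) :
    star (w - (star v ⬝ᵥ w) • v) ⬝ᵥ (w - (star v ⬝ᵥ w) • v) =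
      star w ⬝ᵥ w - (Complex.normSq (star v ⬝ᵥ w) : ℂ) := by
  have hwv : star w ⬝ᵥ v = star (star v ⬝ᵥ w) := by
    rw [← Matrix.star_dotProduct_star, star_star, dotProduct_comm]
  rw [Complex.normSq_eq_conj_mul_self, star_sub, star_smul]
  simp only [sub_dotProduct, dotProduct_sub, smul_dotProduct, dotProduct_smul, hv, hwv,
    smul_eq_mul, starRingEnd_apply]
  ring

theorem Matrix.IsHermitian.star_dotProduct_sq_mulVec {n : Type*} [Fintype n] [DecidableEq n]
    {L : Matrix n n ℂ} (hL : L.IsHermitian) (v : n → ℂ) :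
    star v ⬝ᵥ (L ^ 2 *ᵥ v) = star (L *ᵥ v) ⬝ᵥ (L *ᵥ v) := by
  rw [pow_two, ← Matrix.mulVec_mulVec, Matrix.star_mulVec, hL.eq, Matrix.dotProduct_mulVec]

/-- If `ρ(x) = ∑ₙ qₙ(x)|φₙ(x)⟩⟨φₙ(x)|` is quasi-pure at `x` with
non-degenerate spectrum there, then for every SLD `L` of `ρ` at `x`,
`Tr[ρ(x) L²] = ∑ₙ qₙ(x) · 4(‖φₙ'(x)‖² − |⟨φₙ(x), φₙ'(x)⟩|²)`: the QFI is the convex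
combination of the pure-state QFIs of the eigenvectors. -/
theorem qfi_of_quasiPure_nondegenerate
    {d r : ℕ}
    (ρ : ℝ → Matrix (Fin d) (Fin d) ℂ)
    (q : Fin r → ℝ → ℝ) (φ : Fin r → ℝ → Fin d → ℂ)
    (hortho : ∀ x m n, star (φ m x) ⬝ᵥ φ n x = if m = n then 1 else 0)
    (hqpos : ∀ x n, 0 < q n x)
    (hqsum : ∀ x, ∑ n, q n x = 1)
    (hspec : ∀ x, ρ x = ∑ n, (q n x : ℂ) • ketbra (φ n x) (φ n x))
    (x : ℝ)
    (q' : Fin r → ℝ) (hq' : ∀ n, HasDerivAt (q n) (q' n) x)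
    (φ' : Fin r → Fin d → ℂ)
    (hφ' : ∀ n i, HasDerivAt (fun y => φ n y i) (φ' n i) x)
    (ρ' : Matrix (Fin d) (Fin d) ℂ)
    (hρ' : ∀ i j, HasDerivAt (fun y => ρ y i j) (ρ' i j) x)
    (hquasipure : ∀ k l, star (φ k x) ⬝ᵥ (ρ' *ᵥ φ l x) = 0)
    (hnondeg : ∀ k l, k ≠ l → q k x ≠ q l x)
    (L : Matrix (Fin d) (Fin d) ℂ)
    (hL : L.IsHermitian)
    (hSLD : ρ' = (1/2 : ℂ) • (L * ρ x + ρ x * L)) :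
    (ρ x * L ^ 2).trace =
      ∑ n, (q n x : ℂ) *
        (4 * ((star (φ' n) ⬝ᵥ φ' n) - (Complex.normSq (star (φ n x) ⬝ᵥ φ' n) : ℂ))) := by
  have hρmul : ∀ y u, ρ y *ᵥ u = ∑ k, ((q k y : ℂ) * (star (φ k y) ⬝ᵥ u)) • φ k y := fun y u => by
    rw [hspec, sum_smul_ketbra_mulVec]
  have hbra : ∀ k u, star (φ k x) ⬝ᵥ (ρ x *ᵥ u) = q k x * (star (φ k x) ⬝ᵥ u) := fun k u => by
    simp [hρmul, dotProduct_sum, dotProduct_smul, hortho]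
  have heig : ∀ y l, ρ y *ᵥ φ l y = (q l y : ℂ) • φ l y := fun y l => by
    simp [hρmul, hortho]
  have hderiv : ∀ l, ρ' *ᵥ φ l x + ρ x *ᵥ φ' l = (q' l : ℂ) • φ l x + (q l x : ℂ) • φ' l := by
    intro l
    ext i
    have h := hasDerivAt_mulVec_apply hρ' (hφ' l) i
    simp only [heig] at h
    exact h.unique ((hq' l).ofReal_comp.mul (hφ' l i))
  have hoff : ∀ k l, k ≠ l → star (φ k x) ⬝ᵥ φ' l = 0 := by
    intro k l hkl
    have h := congrArg (star (φ k x) ⬝ᵥ ·) (hderiv l)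
    simp only [dotProduct_add, hquasipure, hbra, dotProduct_smul, hortho, if_neg hkl,
      smul_eq_mul, mul_zero, zero_add] at h
    by_contra h0
    exact hnondeg k l hkl (by exact_mod_cast mul_right_cancel₀ h0 h)
  have hq'zero : ∀ l, (q' l : ℂ) = 0 := by
    intro l
    have h := congrArg (star (φ l x) ⬝ᵥ ·) (hderiv l)
    simpa [dotProduct_add, hquasipure, hbra, dotProduct_smul, hortho] using h
  have hρφ' : ∀ l, ρ x *ᵥ φ' l = ((q l x : ℂ) * (star (φ l x) ⬝ᵥ φ' l)) • φ l x := by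
    intro l
    rw [hρmul, Finset.sum_eq_single l]
    · intro k _ hkl
      rw [hoff k l hkl, mul_zero, zero_smul]
    · simp
  have hρ'φ : ∀ l, ρ' *ᵥ φ l x =
      (1 / 2 : ℂ) • ((q l x : ℂ) • (L *ᵥ φ l x) + ρ x *ᵥ (L *ᵥ φ l x)) := by
    intro l
    rw [hSLD, Matrix.smul_mulVec, Matrix.add_mulVec, ← Matrix.mulVec_mulVec,
      ← Matrix.mulVec_mulVec, heig, Matrix.mulVec_smul]
  have hLzero : ∀ k l, star (φ k x) ⬝ᵥ (L *ᵥ φ l x) = 0 := by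
    intro k l
    have h := hquasipure k l
    rw [hρ'φ, dotProduct_smul, dotProduct_add, dotProduct_smul, hbra, smul_eq_mul, smul_eq_mul,
      ← add_mul] at h
    have hne : (q l x : ℂ) + q k x ≠ 0 := by
      exact_mod_cast (add_pos (hqpos x l) (hqpos x k)).ne'
    simpa [hne] using h
  have hLφ : ∀ l, L *ᵥ φ l x = (2 : ℂ) • (φ' l - (star (φ l x) ⬝ᵥ φ' l) • φ l x) := by
    intro l
    have h := hderiv l
    have hker : ρ x *ᵥ (L *ᵥ φ l x) = 0 := by simp [hρmul, hLzero]
    rw [hρ'φ, hker, hρφ', hq'zero] at h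
    have hne : (q l x : ℂ) ≠ 0 := by exact_mod_cast (hqpos x l).ne'
    ext i
    have hi := congrFun h i
    simp only [Pi.add_apply, Pi.smul_apply, Pi.sub_apply, Pi.zero_apply, smul_eq_mul] at hi ⊢
    apply mul_left_cancel₀ hne
    linear_combination 2 * hi
  rw [hspec, Finset.sum_mul, Matrix.trace_sum]
  refine Finset.sum_congr rfl fun n _ => ?_
  rw [Matrix.smul_mul, Matrix.trace_smul, trace_ketbra_mul, hL.star_dotProduct_sq_mulVec, hLφ,
    ← star_dotProduct_sub_smul_self (by simp [hortho]) (φ' n), star_smul, smul_dotProduct,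
    dotProduct_smul]
  simp only [smul_eq_mul, star_ofNat]
  ring
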